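/- Let K ⊂ ℝⁿ be an isotropic convex body, and let (D_m)_{m≥1} be Borel subsets of ℝⁿ with D_m ⊂ K, |D_m| > 0, |D_m| → 0, such that K'_m := K \ D_m is a convex body for every m. Let g'_m be the centroid of K'_m and M_{K'_m}² the isotropy parameter of K'_m. Then there exist C > 0 and m₀ such that for all m ≥ m₀: | M_{K'_m}^{2n} − (1/n!) ∫_{K'_m} ⋯ ∫_{K'_m} (det(X₁,…,Xₙ))² dX₁ ⋯ dXₙ | ≤ C |K \ K'_m|². -/

import Mathlib

open MeasureTheory Metric Set Filter
open scoped InnerProductSpace Topology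

noncomputable section

/-- A convex body in ℝⁿ: a compact convex set with nonempty interior. -/
def IsConvexBody {n : ℕ} (K : Set (EuclideanSpace ℝ (Fin n))) : Prop :=
  IsCompact K ∧ Convex ℝ K ∧ (interior K).Nonempty

/-- The centroid of a set. -/
def centroid {n : ℕ} (K : Set (EuclideanSpace ℝ (Fin n))) : EuclideanSpace ℝ (Fin n) :=
  ((volume K).toReal)⁻¹ • ∫ x in K, x

/-- `(1/n!) ∫_{A}⋯∫_{A} det(X₁ − g, …, Xₙ − g)² dX₁ ⋯ dXₙ`. -/
def detInt {n : ℕ} (A : Set (EuclideanSpace ℝ (Fin n))) (g : EuclideanSpace ℝ (Fin n)) : ℝ :=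
  ((n.factorial : ℝ))⁻¹ *
    ∫ X in Set.univ.pi (fun _ : Fin n => A),
      (Matrix.det (Matrix.of fun i j : Fin n => X j i - g i)) ^ 2
      ∂(Measure.pi fun _ : Fin n => volume)

/-- `M_K^{2n}`, the 2n-th power of the isotropy parameter of a convex body. -/
def Mpow2n {n : ℕ} (K : Set (EuclideanSpace ℝ (Fin n))) : ℝ := detInt K (centroid K)

/-- The isotropy constant `L_K = M_K / |K|^{(n+2)/(2n)}` of a convex body. -/
def isoL (n : ℕ) (K : Set (EuclideanSpace ℝ (Fin n))) : ℝ :=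
  (Mpow2n K) ^ ((2 * (n : ℝ)))⁻¹ / (volume K).toReal ^ (((n : ℝ) + 2) / (2 * n))

/-- `K` is isotropic with isotropy parameter `M`. -/
def IsIsotropic {n : ℕ} (K : Set (EuclideanSpace ℝ (Fin n))) (M : ℝ) : Prop :=
  0 < M ∧ (∫ x in K, x) = 0 ∧
    ∀ y : EuclideanSpace ℝ (Fin n), (∫ x in K, (⟪x, y⟫_ℝ) ^ 2) = M ^ 2 * ‖y‖ ^ 2

/-- `(N, q)` witnesses positive generalized Gauss curvature of `K` at `X₀`. -/
def CurvWitness {n : ℕ} (K : Set (EuclideanSpace ℝ (Fin n))) (X₀ N : EuclideanSpace ℝ (Fin n))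
    (q : QuadraticForm ℝ (EuclideanSpace ℝ (Fin n))) : Prop :=
  ‖N‖ = 1 ∧ (∀ x ∈ K, 0 ≤ ⟪x - X₀, N⟫_ℝ) ∧
  (∀ Y : EuclideanSpace ℝ (Fin n), ⟪Y, N⟫_ℝ = 0 → Y ≠ 0 → 0 < q Y) ∧
  ∀ ε > (0 : ℝ), ∃ a > (0 : ℝ), ∀ (Y : EuclideanSpace ℝ (Fin n)) (y : ℝ), ⟪Y, N⟫_ℝ = 0 →
    X₀ + Y + y • N ∈ frontier K ∩ Metric.ball X₀ a →
    (1 - ε) * q Y ≤ y ∧ y ≤ (1 + ε) * q Y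

/-- `K` has positive generalized Gauss curvature at `X₀`. -/
def HasPosGenCurvature {n : ℕ} (K : Set (EuclideanSpace ℝ (Fin n)))
    (X₀ : EuclideanSpace ℝ (Fin n)) : Prop :=
  ∃ N q, CurvWitness K X₀ N q

/-- `K` is a local maximizer for the isotropy constant (Hausdorff distance). -/
def IsLocalMaxIso {n : ℕ} (K : Set (EuclideanSpace ℝ (Fin n))) : Prop :=
  ∃ ε > (0 : ℝ), ∀ K' : Set (EuclideanSpace ℝ (Fin n)), IsConvexBody K' →
    hausdorffDist K' K < ε → isoL n K' ≤ isoL n K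

/-- `K` is a local minimizer for the isotropy constant (Hausdorff distance). -/
def IsLocalMinIso {n : ℕ} (K : Set (EuclideanSpace ℝ (Fin n))) : Prop :=
  ∃ ε > (0 : ℝ), ∀ K' : Set (EuclideanSpace ℝ (Fin n)), IsConvexBody K' →
    hausdorffDist K' K < ε → isoL n K ≤ isoL n K'

/-- `X₀` is a point of local strict convexity of `∂K`. -/
def IsLocalStrictConvexPoint {n : ℕ} (K : Set (EuclideanSpace ℝ (Fin n)))
    (X₀ : EuclideanSpace ℝ (Fin n)) : Prop :=
  X₀ ∈ frontier K ∧
    ¬ ∃ A B : EuclideanSpace ℝ (Fin n), A ≠ B ∧ segment ℝ A B ⊆ frontier K ∧ X₀ ∈ segment ℝ A B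


/-- The second moment matrix of `A` about the point `g`. -/
def secondMoment {n : ℕ} (A : Set (EuclideanSpace ℝ (Fin n))) (g : EuclideanSpace ℝ (Fin n)) :
    Fin n → Fin n → ℝ :=
  fun i j => ∫ x in A, (x i - g i) * (x j - g j)

/-- The polynomial in the entries of a second moment matrix that computes `detInt`. -/
def momentPoly {n : ℕ} (S : Fin n → Fin n → ℝ) : ℝ :=
  ((n.factorial : ℝ))⁻¹ * ∑ σ : Equiv.Perm (Fin n), ∑ τ : Equiv.Perm (Fin n),
    ((Equiv.Perm.sign σ : ℤ) : ℝ) * ((Equiv.Perm.sign τ : ℤ) : ℝ) * ∏ i, S (σ i) (τ i)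

theorem contDiff_momentPoly {n : ℕ} : ContDiff ℝ 1 (momentPoly (n := n)) := by
  unfold momentPoly
  refine contDiff_const.mul (ContDiff.sum fun σ _ => ContDiff.sum fun τ _ =>
    contDiff_const.mul (contDiff_prod fun i _ => ?_))
  exact (contDiff_apply_apply (𝕜 := ℝ) (E := ℝ) (σ i) (τ i))

theorem integrableOn_coord_mul_coord {n : ℕ} {A : Set (EuclideanSpace ℝ (Fin n))}
    (hA : IsCompact A) (g : EuclideanSpace ℝ (Fin n)) (i j : Fin n) :
    IntegrableOn (fun x : EuclideanSpace ℝ (Fin n) => (x i - g i) * (x j - g j)) A :=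
  ContinuousOn.integrableOn_compact hA (by fun_prop)

theorem detInt_eq_momentPoly {n : ℕ} {A : Set (EuclideanSpace ℝ (Fin n))}
    (hA : IsCompact A) (g : EuclideanSpace ℝ (Fin n)) :
    detInt A g = momentPoly (secondMoment A g) := by
  have hexp : ∀ X : Fin n → EuclideanSpace ℝ (Fin n),
      (Matrix.det (Matrix.of fun i j : Fin n => X j i - g i)) ^ 2 =
      ∑ σ : Equiv.Perm (Fin n), ∑ τ : Equiv.Perm (Fin n),
        ((Equiv.Perm.sign σ : ℤ) : ℝ) * ((Equiv.Perm.sign τ : ℤ) : ℝ) *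
          ∏ i, ((X i (σ i) - g (σ i)) * (X i (τ i) - g (τ i))) := by
    intro X
    rw [Matrix.det_apply', sq, Finset.sum_mul_sum]
    refine Finset.sum_congr rfl fun σ _ => Finset.sum_congr rfl fun τ _ => ?_
    simp only [Matrix.of_apply, Finset.prod_mul_distrib]
    ring
  have hint : ∀ σ τ : Equiv.Perm (Fin n), Integrable
      (fun X : Fin n → EuclideanSpace ℝ (Fin n) =>
        ((Equiv.Perm.sign σ : ℤ) : ℝ) * ((Equiv.Perm.sign τ : ℤ) : ℝ) *
          ∏ i, ((X i (σ i) - g (σ i)) * (X i (τ i) - g (τ i))))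
      (Measure.pi fun _ : Fin n => volume.restrict A) := fun σ τ =>
    (Integrable.fintype_prod (f := fun i (x : EuclideanSpace ℝ (Fin n)) =>
      (x (σ i) - g (σ i)) * (x (τ i) - g (τ i)))
      fun i => integrableOn_coord_mul_coord hA g (σ i) (τ i)).const_mul _
  unfold detInt momentPoly
  congr 1
  rw [Measure.restrict_pi_pi]
  simp only [hexp]
  rw [integral_finsetSum _ fun σ _ => integrable_finsetSum _ fun τ _ => hint σ τ]
  refine Finset.sum_congr rfl fun σ _ => ?_
  rw [integral_finsetSum _ fun τ _ => hint σ τ]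
  refine Finset.sum_congr rfl fun τ _ => ?_
  rw [integral_const_mul]
  congr 1
  exact integral_fintype_prod_eq_prod (f := fun i (x : EuclideanSpace ℝ (Fin n)) =>
      (x (σ i) - g (σ i)) * (x (τ i) - g (τ i)))

theorem setIntegral_coord {n : ℕ} {A : Set (EuclideanSpace ℝ (Fin n))}
    (hA : IsCompact A) (i : Fin n) : ∫ x in A, x i = (∫ x in A, x) i :=
  (EuclideanSpace.proj (𝕜 := ℝ) i).integral_comp_comm
    (φ := fun x : EuclideanSpace ℝ (Fin n) => x) (continuousOn_id.integrableOn_compact hA)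

theorem volume_toReal_smul_centroid {n : ℕ} {A : Set (EuclideanSpace ℝ (Fin n))}
    (hA : (volume A).toReal ≠ 0) : (volume A).toReal • centroid A = ∫ x in A, x := by
  rw [centroid, smul_inv_smul₀ hA]

/-- The parallel axis theorem. -/
theorem secondMoment_centroid {n : ℕ} {A : Set (EuclideanSpace ℝ (Fin n))}
    (hA : IsCompact A) (hv : (volume A).toReal ≠ 0) (i j : Fin n) :
    secondMoment A (centroid A) i j =
      secondMoment A 0 i j - (volume A).toReal * (centroid A i * centroid A j) := by
  have hc : ∀ k, ∫ x in A, x k = (volume A).toReal * centroid A k := fun k => by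
    rw [setIntegral_coord hA, ← volume_toReal_smul_centroid hv]; simp
  set g := centroid A
  have h0 := integrableOn_coord_mul_coord hA 0 i j
  have hk : ∀ k, IntegrableOn (fun x : EuclideanSpace ℝ (Fin n) => x k) A := fun k =>
    ContinuousOn.integrableOn_compact hA (by fun_prop)
  simp only [PiLp.zero_apply, sub_zero] at h0
  have hconst : IntegrableOn (fun _ : EuclideanSpace ℝ (Fin n) => g i * g j) A :=
    continuousOn_const.integrableOn_compact hA
  have hEq : ∀ x : EuclideanSpace ℝ (Fin n), (x i - g i) * (x j - g j) =
      x i * x j - g j * x i - g i * x j + g i * g j := fun x => by ring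
  simp only [secondMoment, PiLp.zero_apply, sub_zero, hEq]
  have hi : IntegrableOn (fun x : EuclideanSpace ℝ (Fin n) => g j * x i) A := (hk i).const_mul _
  have hj : IntegrableOn (fun x : EuclideanSpace ℝ (Fin n) => g i * x j) A := (hk j).const_mul _
  have h1 : IntegrableOn (fun x : EuclideanSpace ℝ (Fin n) => x i * x j - g j * x i) A :=
    h0.sub hi
  have h2 : IntegrableOn (fun x : EuclideanSpace ℝ (Fin n) =>
      x i * x j - g j * x i - g i * x j) A := h1.sub hj
  rw [integral_add h2 hconst, integral_sub h1 hj, integral_sub h0 hi, integral_const_mul, integral_const_mul, hc, hc,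
    setIntegral_const, Measure.real, smul_eq_mul]
  ring

/-- **Lemma 3, inner case (Meyer–Reisner).** The centered determinant integral of
`K'_m = K \ D_m` differs from the uncentered one by `O(|K \ K'_m|²)`. -/
theorem Mpow2n_diff_inner_sets {n : ℕ} (K : Set (EuclideanSpace ℝ (Fin n))) (M : ℝ)
    (hK : IsConvexBody K) (hiso : IsIsotropic K M)
    (D : ℕ → Set (EuclideanSpace ℝ (Fin n)))
    (hmeas : ∀ m, MeasurableSet (D m))
    (hsub : ∀ m, D m ⊆ K)
    (hpos : ∀ m, 0 < volume (D m))
    (hto0 : Tendsto (fun m => volume (D m)) atTop (𝓝 0))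
    (hconv : ∀ m, IsConvexBody (K \ D m)) :
    ∃ c > (0 : ℝ), ∃ m₀ : ℕ, ∀ m ≥ m₀,
      |Mpow2n (K \ D m) - detInt (K \ D m) 0|
        ≤ c * ((volume (K \ (K \ D m))).toReal) ^ 2 := by
  have hKc := hK.1
  have hKfin : volume K ≠ ⊤ := hKc.measure_ne_top
  have hV : 0 < (volume K).toReal := ENNReal.toReal_pos
    (Measure.measure_pos_of_nonempty_interior _ hK.2.2).ne' hKfin
  set V := (volume K).toReal with hVdef
  obtain ⟨R, hRpos, hR⟩ := hKc.isBounded.exists_pos_norm_le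
  have hdfin : ∀ m, volume (D m) < ⊤ := fun m =>
    (measure_mono (hsub m)).trans_lt hKc.measure_lt_top
  set d : ℕ → ℝ := fun m => (volume (D m)).toReal with hd
  have hd0 : Tendsto d atTop (𝓝 0) := by
    simpa [hd, Function.comp_def] using (ENNReal.tendsto_toReal ENNReal.zero_ne_top).comp hto0
  have hdn : ∀ m, 0 ≤ d m := fun m => ENNReal.toReal_nonneg
  have hvol : ∀ m, (volume (K \ D m)).toReal = V - d m := fun m => by
    rw [measure_sdiff (hsub m) (hmeas m).nullMeasurableSet (hdfin m).ne,
      ENNReal.toReal_sub_of_le (measure_mono (hsub m)) hKfin]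
  have hsmall : ∀ᶠ m in atTop, d m < V / 2 := hd0.eventually_lt_const (by positivity)
  have hcent : ∀ m, d m < V / 2 → ∀ i, |(V - d m) * centroid (K \ D m) i| ≤ R * d m := by
    intro m hm i
    have h1 := volume_toReal_smul_centroid (A := K \ D m) (by rw [hvol]; linarith)
    rw [hvol, setIntegral_sdiff (hmeas m) (f := fun x => x)
      (continuousOn_id.integrableOn_compact hKc) (hsub m), hiso.2.1, zero_sub] at h1
    calc |(V - d m) * centroid (K \ D m) i|
        = ‖((V - d m) • centroid (K \ D m)) i‖ := by simp
      _ ≤ ‖(V - d m) • centroid (K \ D m)‖ := PiLp.norm_apply_le _ i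
      _ = ‖∫ x in D m, x‖ := by rw [h1, norm_neg]
      _ ≤ R * d m := norm_setIntegral_le_of_norm_le_const (hdfin m)
          fun x hx => hR x (hsub m hx)
  have hshift : ∀ m, d m < V / 2 →
      dist (secondMoment (K \ D m) (centroid (K \ D m))) (secondMoment (K \ D m) 0) ≤
        2 / V * R ^ 2 * d m ^ 2 := by
    intro m hm
    have hw : 0 < V - d m := by linarith
    refine (dist_pi_le_iff (by positivity)).2 fun i => (dist_pi_le_iff (by positivity)).2
      fun j => ?_
    rw [secondMoment_centroid (hconv m).1 (by rw [hvol]; exact hw.ne'), hvol, Real.dist_eq,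
      sub_sub_cancel_left, abs_neg]
    have hprod := mul_le_mul (hcent m hm i) (hcent m hm j) (abs_nonneg _)
      (mul_nonneg hRpos.le (hdn m))
    rw [← abs_mul] at hprod
    calc |(V - d m) * (centroid (K \ D m) i * centroid (K \ D m) j)|
        = (V - d m)⁻¹ * |(V - d m) * centroid (K \ D m) i *
            ((V - d m) * centroid (K \ D m) j)| := by
          rw [abs_mul _ (_ * _), abs_mul (_ * _) (_ * _), abs_mul, abs_mul, abs_mul,
            abs_of_pos hw]
          field_simp
      _ ≤ 2 / V * (R * d m * (R * d m)) := by
          refine mul_le_mul ?_ hprod (abs_nonneg _) (by positivity)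
          rw [← inv_div]
          exact inv_anti₀ (by positivity) (by linarith)
      _ = 2 / V * R ^ 2 * d m ^ 2 := by ring
  have hmom : ∀ m, dist (secondMoment (K \ D m) 0) (secondMoment K 0) ≤ R ^ 2 * d m := by
    intro m
    have hdm := hdn m
    refine (dist_pi_le_iff (by positivity)).2 fun i => (dist_pi_le_iff (by positivity)).2
      fun j => ?_
    simp only [secondMoment]
    rw [setIntegral_sdiff (hmeas m) (integrableOn_coord_mul_coord hKc 0 i j) (hsub m),
      Real.dist_eq, sub_sub_cancel_left, abs_neg]
    rw [← Real.norm_eq_abs]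
    refine norm_setIntegral_le_of_norm_le_const (hdfin m) fun x hx => ?_
    have hxR := hR x (hsub m hx)
    simp only [PiLp.zero_apply, sub_zero, norm_mul, sq]
    exact mul_le_mul ((PiLp.norm_apply_le x i).trans hxR) ((PiLp.norm_apply_le x j).trans hxR)
      (norm_nonneg _) hRpos.le
  obtain ⟨L, t, ht, hL⟩ := (contDiff_momentPoly (n := n)).contDiffAt.exists_lipschitzOnWith
    (x := secondMoment K 0)
  have hlim0 : Tendsto (fun m => secondMoment (K \ D m) 0) atTop (𝓝 (secondMoment K 0)) :=
    tendsto_iff_dist_tendsto_zero.2 <| squeeze_zero (fun _ => dist_nonneg) hmom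
      (by simpa using hd0.const_mul (R ^ 2))
  have hlimc : Tendsto (fun m => secondMoment (K \ D m) (centroid (K \ D m))) atTop
      (𝓝 (secondMoment K 0)) := by
    have hlim : Tendsto (fun m => 2 / V * R ^ 2 * d m ^ 2) atTop (𝓝 0) := by
      simpa using (hd0.pow 2).const_mul (2 / V * R ^ 2)
    refine hlim0.congr_dist (squeeze_zero' (Eventually.of_forall fun _ => dist_nonneg)
      (hsmall.mono fun m hm => ?_) hlim)
    rw [dist_comm]
    exact hshift m hm
  obtain ⟨m₀, hm₀⟩ := eventually_atTop.1
    (hsmall.and ((hlim0.eventually_mem ht).and (hlimc.eventually_mem ht)))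
  refine ⟨(L + 1) * (2 / V * R ^ 2), by positivity, m₀, fun m hm => ?_⟩
  obtain ⟨hs, h0, hc⟩ := hm₀ m hm
  rw [Mpow2n, detInt_eq_momentPoly (hconv m).1, detInt_eq_momentPoly (hconv m).1,
    sdiff_sdiff_cancel_left (hsub m), ← Real.dist_eq]
  calc _ ≤ L * dist (secondMoment (K \ D m) (centroid (K \ D m))) (secondMoment (K \ D m) 0) :=
        hL.dist_le_mul _ hc _ h0
    _ ≤ (L + 1) * (2 / V * R ^ 2 * d m ^ 2) :=
        mul_le_mul (by linarith) (hshift m hs) dist_nonneg (by positivity)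
    _ = _ := by ring
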